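/- Assume N ≥ 2. Suppose δ ≥ 1 is an integer such that ord_0(f_h) ≤ δ for every h ∈ GL_{N+1}(k), and s ≥ −1 is an integer such that the Krull dimension of k[X_0,…,X_N]/J is at most s+1. Assume moreover that for every h ∈ GL_{N+1}(k) with ord_0(f_h) = δ, the lowest-degree homogeneous part in_δ(f_h) contains a monomial in which the variable x_{N−1} occurs (this quantified condition expresses that at every point P ∈ H(k) where H has multiplicity δ, the projective tangent cone P(C_P H) ⊂ P^{N−1}_k is not the cone over a hypersurface contained in a projective hyperplane of P^{N−1}_k). If d > (δ−1)·min(N+1, s+3), then for every g ∈ GL_{N+1}(k) and every nonzero α ∈ ℤ^{N+1} with Σ_{i=0}^N α_i = 0, one has deg_α(F∘g) > 0; that is, F satisfies the Hilbert–Mumford criterion for stability, so H is stable. -/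

import Mathlib

open MvPolynomial

/-- The `α`-degree of a multivariate polynomial `G`: the maximum of `∑ i, m i * α i`
over the monomials `X^m` occurring in `G` with nonzero coefficient (0 if `G = 0`). -/
noncomputable def adeg {k : Type*} [CommSemiring k] {n : ℕ} (α : Fin n → ℤ)
    (G : MvPolynomial (Fin n) k) : ℤ :=
  if h : G.support.Nonempty then G.support.sup' h (fun m => ∑ i, (m i : ℤ) * α i) else 0

/-- `F ∘ g`: the polynomial obtained from `F` by the substitution `X i ↦ ∑ j, g i j • X j`. -/
noncomputable def substGL {k : Type*} [CommRing k] {n : ℕ}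
    (g : Matrix (Fin n) (Fin n) k) (F : MvPolynomial (Fin n) k) :
    MvPolynomial (Fin n) k :=
  aeval (fun i => ∑ j, C (g i j) * X j) F

/-- Dehomogenization with respect to the last variable:
`G(X_0, …, X_N) ↦ G(x_0, …, x_{N-1}, 1)`. -/
noncomputable def dehom {k : Type*} [CommRing k] {N : ℕ}
    (G : MvPolynomial (Fin (N+1)) k) : MvPolynomial (Fin N) k :=
  aeval (fun i : Fin (N+1) => if h : (i : ℕ) < N then X ⟨i, h⟩ else 1) G

/-- `ord_0 f`: the minimal total degree of a monomial occurring in `f`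
with nonzero coefficient (0 if `f = 0`). -/
noncomputable def ord0 {k : Type*} [CommSemiring k] {N : ℕ}
    (f : MvPolynomial (Fin N) k) : ℕ :=
  if h : f.support.Nonempty then f.support.inf' h (fun m => ∑ i, m i) else 0

/-- The ideal generated by `F` and its partial derivatives, defining the singular
locus `H_sing` of the hypersurface `H = {F = 0}`. -/
noncomputable def jacobianIdeal {k : Type*} [CommRing k] {N : ℕ}
    (F : MvPolynomial (Fin (N+1)) k) : Ideal (MvPolynomial (Fin (N+1)) k) :=
  Ideal.span ({F} ∪ Set.range (fun i => pderiv i F))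

theorem substGL_substGL {k : Type*} [CommRing k] {n : ℕ} (g h : Matrix (Fin n) (Fin n) k)
    (F : MvPolynomial (Fin n) k) : substGL g (substGL h F) = substGL (h * g) F := by
  unfold substGL
  rw [← AlgHom.comp_apply]
  congr 1
  ext1 i
  simp only [AlgHom.comp_apply, aeval_X, map_sum, map_mul, algHom_C, Matrix.mul_apply,
    Finset.mul_sum, Finset.sum_mul, algebraMap_eq, mul_assoc]
  exact Finset.sum_comm

theorem substGL_one {k : Type*} [CommRing k] {n : ℕ} (F : MvPolynomial (Fin n) k) :
    substGL 1 F = F := by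
  simp [substGL, Matrix.one_apply]

theorem substGL_inv_substGL {k : Type*} [Field k] {n : ℕ}
    (g : Matrix.GeneralLinearGroup (Fin n) k) (F : MvPolynomial (Fin n) k) :
    substGL (↑g⁻¹ : Matrix (Fin n) (Fin n) k) (substGL (↑g) F) = F := by
  rw [substGL_substGL, ← Units.val_mul, mul_inv_cancel, Units.val_one, substGL_one]

theorem substGL_substGL_inv {k : Type*} [Field k] {n : ℕ}
    (g : Matrix.GeneralLinearGroup (Fin n) k) (F : MvPolynomial (Fin n) k) :
    substGL (↑g) (substGL (↑g⁻¹ : Matrix (Fin n) (Fin n) k) F) = F := by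
  rw [substGL_substGL, ← Units.val_mul, inv_mul_cancel, Units.val_one, substGL_one]

theorem isHomogeneous_substGL {k : Type*} [CommRing k] {n d : ℕ} (g : Matrix (Fin n) (Fin n) k)
    {F : MvPolynomial (Fin n) k} (hF : F.IsHomogeneous d) : (substGL g F).IsHomogeneous d := by
  have := hF.aeval (S := k) (n := 1) (fun i => ∑ j, C (g i j) * X j)
    (fun i => IsHomogeneous.sum _ _ _ fun j _ => isHomogeneous_C_mul_X _ _)
  rwa [one_mul] at this

theorem pderiv_substGL {k : Type*} [CommRing k] {n : ℕ} (g : Matrix (Fin n) (Fin n) k)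
    (F : MvPolynomial (Fin n) k) (j : Fin n) :
    pderiv j (substGL g F) = ∑ i, C (g i j) * substGL g (pderiv i F) := by
  unfold substGL
  induction F using MvPolynomial.induction_on with
  | C a => simp
  | add p q hp hq => simp only [map_add, hp, hq, mul_add, Finset.sum_add_distrib]
  | mul_X p i hp =>
    have hX : pderiv j (∑ l, C (g i l) * X l) = C (g i j) := by
      simp [pderiv_X, Pi.single_apply]
    simp only [map_mul, aeval_X, Derivation.leibniz, hp, hX, smul_eq_mul, map_add, mul_add,
      Finset.sum_add_distrib, pderiv_X, Pi.single_apply]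
    congr 1
    · simp [mul_comm]
    · simp only [Finset.mul_sum]
      exact Finset.sum_congr rfl fun l _ => by ring

theorem substGL_pderiv {k : Type*} [Field k] {n : ℕ} (g : Matrix.GeneralLinearGroup (Fin n) k)
    (F : MvPolynomial (Fin n) k) (i : Fin n) :
    substGL (↑g) (pderiv i F) =
      ∑ j, C ((↑g⁻¹ : Matrix (Fin n) (Fin n) k) j i) * pderiv j (substGL (↑g) F) := by
  have h := pderiv_substGL (↑g⁻¹ : Matrix (Fin n) (Fin n) k) (substGL (↑g) F) i
  rw [substGL_inv_substGL] at h
  rw [h]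
  conv_lhs => unfold substGL
  simp only [map_sum, map_mul, algHom_C, algebraMap_eq]
  refine Finset.sum_congr rfl fun j _ => ?_
  congr 1
  exact substGL_substGL_inv g _

/-- The ideal of the polynomials vanishing on a coordinate subspace, as the kernel of the
restriction to that subspace. -/
noncomputable def coordIdeal (k : Type*) [Field k] (n j : ℕ) : Ideal (MvPolynomial (Fin n) k) :=
  RingHom.ker (aeval (fun i : Fin n => if (i : ℕ) < j then 0 else X i) :
    MvPolynomial (Fin n) k →ₐ[k] MvPolynomial (Fin n) k)

instance coordIdeal_isPrime (k : Type*) [Field k] (n j : ℕ) : (coordIdeal k n j).IsPrime :=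
  RingHom.ker_isPrime _

theorem coordIdeal_lt {k : Type*} [Field k] {n j : ℕ} (hj : j < n) :
    coordIdeal k n j < coordIdeal k n (j + 1) := by
  refine lt_of_le_of_ne (fun f hf => ?_) fun h => ?_
  · rw [coordIdeal, RingHom.mem_ker] at hf ⊢
    have h := congrArg (aeval (fun i : Fin n => if (i : ℕ) < j + 1 then 0 else X i) :
      MvPolynomial (Fin n) k →ₐ[k] MvPolynomial (Fin n) k) hf
    rw [map_zero, ← AlgHom.comp_apply] at h
    convert h using 2
    ext1 i
    simp only [AlgHom.comp_apply, aeval_X]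
    split_ifs <;> first | omega | simp_all
  · have : (X ⟨j, hj⟩ : MvPolynomial (Fin n) k) ∈ coordIdeal k n j := by
      rw [h]; simp [coordIdeal, RingHom.mem_ker]
    simp [coordIdeal, RingHom.mem_ker] at this

theorem le_height_coordIdeal {k : Type*} [Field k] {n j : ℕ} (hj : j ≤ n) :
    (j : ℕ∞) ≤ (coordIdeal k n j).height := by
  induction j with
  | zero => simp
  | succ j ih =>
    push_cast
    exact (add_le_add_left (ih (by omega)) 1).trans
      (Ideal.height_add_one_le_of_lt_of_isPrime (coordIdeal_lt hj))

theorem mem_coordIdeal_self {k : Type*} [Field k] {n : ℕ} {f : MvPolynomial (Fin n) k}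
    (hf : constantCoeff f = 0) : f ∈ coordIdeal k n n := by
  have h : (fun i : Fin n => if (i : ℕ) < n then (0 : MvPolynomial (Fin n) k) else X i) =
      fun _ => 0 := funext fun i => if_pos i.isLt
  rw [coordIdeal, RingHom.mem_ker, h, aeval_zero', hf, map_zero]

theorem constantCoeff_eq_zero_of_isHomogeneous {k : Type*} [CommSemiring k] {σ : Type*} {d : ℕ}
    {f : MvPolynomial σ k} (hf : f.IsHomogeneous d) (hd : d ≠ 0) : constantCoeff f = 0 := by
  rw [constantCoeff_eq]
  exact hf.coeff_eq_zero (by simpa using hd.symm)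

/-- Cutting affine space by the positive-degree equations in `S` lowers the dimension by at
most the size of `S`; if these equations cut out a subset of the singular locus of `F` in the
coordinates given by `g`, this bounds the dimension of that locus from below. -/
theorem le_ringKrullDim_quotient_jacobianIdeal {k : Type*} [Field k] {N : ℕ}
    (F : MvPolynomial (Fin (N+1)) k) (g : Matrix.GeneralLinearGroup (Fin (N+1)) k)
    (S : Set (MvPolynomial (Fin (N+1)) k)) (hS0 : ∀ f ∈ S, constantCoeff f = 0)
    (hF : substGL (↑g) F ∈ Ideal.span S)
    (hpd : ∀ j, pderiv j (substGL (↑g) F) ∈ Ideal.span S) :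
    ((N + 1 : ℕ) : WithBot ℕ∞) ≤
      ringKrullDim (MvPolynomial (Fin (N+1)) k ⧸ jacobianIdeal F) + S.encard := by
  have h1 := Ideal.height_le_ringKrullDim_quotient_add_encard (p := coordIdeal k (N+1) (N+1)) S
    fun f hf => mem_coordIdeal_self (hS0 f hf)
  have h2 : ((N + 1 : ℕ) : WithBot ℕ∞) ≤ (coordIdeal k (N+1) (N+1)).height := by
    exact_mod_cast le_height_coordIdeal (k := k) (le_refl (N+1))
  refine (h2.trans h1).trans ?_
  gcongr
  let φ : MvPolynomial (Fin (N+1)) k →+* MvPolynomial (Fin (N+1)) k ⧸ Ideal.span S :=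
    (Ideal.Quotient.mk _).comp
      (aeval (fun i => ∑ j, C (g.val i j) * X j) :
        MvPolynomial (Fin (N+1)) k →ₐ[k] MvPolynomial (Fin (N+1)) k).toRingHom
  have hφ : ∀ p, φ p = Ideal.Quotient.mk _ (substGL (↑g) p) := fun p => rfl
  have hle : jacobianIdeal F ≤ RingHom.ker φ := by
    rw [jacobianIdeal, Ideal.span_le]
    rintro _ (rfl | ⟨i, rfl⟩)
    · rw [SetLike.mem_coe, RingHom.mem_ker, hφ, Ideal.Quotient.eq_zero_iff_mem]
      exact hF
    · rw [SetLike.mem_coe, RingHom.mem_ker, hφ, Ideal.Quotient.eq_zero_iff_mem, substGL_pderiv]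
      exact Ideal.sum_mem _ fun j _ => Ideal.mul_mem_left _ _ (hpd j)
  refine ringKrullDim_le_of_surjective (Ideal.Quotient.lift _ φ fun a ha => hle ha)
    (Ideal.Quotient.lift_surjective_of_surjective _ _ fun y => ?_)
  obtain ⟨p, rfl⟩ := Ideal.Quotient.mk_surjective y
  exact ⟨substGL (↑g⁻¹ : Matrix (Fin (N+1)) (Fin (N+1)) k) p, by rw [hφ, substGL_substGL_inv]⟩

theorem weight_lower_bound {n : ℕ} {α : Fin n → ℤ} (hα : Monotone α) (m : Fin n →₀ ℕ) {q : Fin n}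
    (hm : ∀ i < q, m i = 0) : ((∑ i, m i : ℕ) : ℤ) * α q ≤ ∑ i, (m i : ℤ) * α i := by
  push_cast
  rw [Finset.sum_mul]
  refine Finset.sum_le_sum fun i _ => ?_
  rcases lt_or_ge i q with h | h
  · simp [hm i h]
  · exact mul_le_mul_of_nonneg_left (hα h) (by positivity)

theorem sum_eq_of_isHomogeneous {k : Type*} [CommSemiring k] {n d : ℕ}
    {G : MvPolynomial (Fin n) k} (hG : G.IsHomogeneous d) {m : Fin n →₀ ℕ} (hm : m ∈ G.support) :
    ∑ i, m i = d := by
  have := hG (mem_support_iff.mp hm)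
  rwa [Finsupp.weight_apply, Finsupp.sum_fintype _ _ (by simp), Finset.sum_congr rfl
    (fun i _ => by simp : ∀ i ∈ Finset.univ, m i • (1 : Fin n → ℕ) i = m i)] at this

theorem add_single_mem_support_of_mem_support_pderiv {k : Type*} [CommSemiring k] {σ : Type*}
    {G : MvPolynomial σ k} {i : σ} {m : σ →₀ ℕ} (hm : m ∈ (pderiv i G).support) :
    m + Finsupp.single i 1 ∈ G.support := by
  rw [mem_support_iff, coeff_pderiv] at hm
  exact mem_support_iff.mpr (left_ne_zero_of_mul hm)

/-- If `dim H_sing ≤ D - 1`, the linear subspace `X_0 = ⋯ = X_{q-1} = 0` meets the singular locus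
in the expected dimension at most, which forces monomials of high degree in `X_q, …, X_N`
into the equation. -/
theorem weight_pair_le_zero {k : Type*} [Field k] {N d D : ℕ} (hd : 2 ≤ d)
    {F : MvPolynomial (Fin (N+1)) k} (hF : F.IsHomogeneous d)
    (hsing : ringKrullDim (MvPolynomial (Fin (N+1)) k ⧸ jacobianIdeal F) ≤ (D : WithBot ℕ∞))
    (g : Matrix.GeneralLinearGroup (Fin (N+1)) k) {α : Fin (N+1) → ℤ} (hα : Monotone α)
    (hw : ∀ m ∈ (substGL (↑g) F).support, ∑ i, (m i : ℤ) * α i ≤ 0)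
    {p q : Fin (N+1)} (hpq : p ≤ q) (hD : (p : ℕ) + q + D ≤ N) :
    α p + ((d : ℤ) - 1) * α q ≤ 0 := by
  have hG := isHomogeneous_substGL g.val hF
  set G := substGL g.val F with hGdef
  have hd' : (2 : ℤ) ≤ d := by exact_mod_cast hd
  by_contra! hcon
  have hmemG : G ∈ Ideal.span (X '' Set.Iio q : Set (MvPolynomial (Fin (N+1)) k)) := by
    rw [mem_ideal_span_X_image]
    by_contra! h
    obtain ⟨m, hm, hm0⟩ := h
    have h1 := (weight_lower_bound hα m hm0).trans (hw m hm)
    rw [sum_eq_of_isHomogeneous hG hm] at h1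
    have h2 := hα hpq
    nlinarith
  have hmemP : ∀ i, p ≤ i →
      pderiv i G ∈ Ideal.span (X '' Set.Iio q : Set (MvPolynomial (Fin (N+1)) k)) := by
    intro i hi
    rw [mem_ideal_span_X_image]
    by_contra! h
    obtain ⟨m, hm, hm0⟩ := h
    have hm' := add_single_mem_support_of_mem_support_pderiv hm
    rcases lt_or_ge i q with hiq | hiq
    · have h1 := hw _ hm'
      have h2 := sum_eq_of_isHomogeneous hG hm'
      have h3 := weight_lower_bound hα m hm0
      simp only [Finsupp.add_apply, Finsupp.single_apply, Nat.cast_add, Nat.cast_ite, add_mul,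
        Finset.sum_add_distrib] at h1 h2
      simp at h1 h2
      have h4 : ((∑ i, m i : ℕ) : ℤ) = d - 1 := by omega
      rw [h4] at h3
      have h5 := hα hi
      linarith
    · obtain ⟨j, hj, hj0⟩ := mem_ideal_span_X_image.mp hmemG _ hm'
      have hij : i ≠ j := fun h => absurd (h ▸ hj : i ∈ Set.Iio q) (not_lt.mpr hiq)
      rw [Finsupp.add_apply, Finsupp.single_eq_of_ne' hij, add_zero] at hj0
      exact hj0 (hm0 j hj)
  have hmono := Ideal.span_mono (Set.subset_union_left
    (s := (X '' Set.Iio q : Set (MvPolynomial (Fin (N+1)) k)))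
    (t := (fun i => pderiv i G) '' Set.Iio p))
  have key := le_ringKrullDim_quotient_jacobianIdeal F g
    (X '' Set.Iio q ∪ (fun i => pderiv i G) '' Set.Iio p) ?_ (hmono hmemG) fun j => ?_
  · have hcard : ((X '' Set.Iio q ∪ (fun i => pderiv i G) '' Set.Iio p :
        Set (MvPolynomial (Fin (N+1)) k))).encard ≤ ((q + p : ℕ) : ℕ∞) := by
      have hI : ∀ r : Fin (N+1), (Set.Iio r).encard = (r : ℕ) := fun r => by
        rw [← Finset.coe_Iio, Set.encard_coe_eq_coe_finsetCard, Fin.card_Iio]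
      refine (Set.encard_union_le _ _).trans ?_
      push_cast
      exact add_le_add ((Set.encard_image_le _ _).trans (hI q).le)
        ((Set.encard_image_le _ _).trans (hI p).le)
    have h : ((N + 1 : ℕ) : WithBot ℕ∞) ≤ ((D + (q + p) : ℕ) : WithBot ℕ∞) := by
      refine key.trans ?_
      push_cast
      refine add_le_add hsing ?_
      exact_mod_cast hcard
    have : N + 1 ≤ D + (q + p) := by exact_mod_cast h
    omega
  · rintro _ (⟨i, -, rfl⟩ | ⟨i, -, rfl⟩)
    · simp
    · exact constantCoeff_eq_zero_of_isHomogeneous hG.pderiv (by omega)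
  · rcases lt_or_ge j p with hj | hj
    · exact Ideal.subset_span (Or.inr ⟨j, hj, rfl⟩)
    · exact hmono (hmemP j hj)

theorem dehom_monomial {k : Type*} [CommRing k] {N : ℕ} (m : Fin (N+1) →₀ ℕ) (c : k) :
    dehom (monomial m c) =
      monomial (m.comapDomain Fin.castSucc (Fin.castSucc_injective N).injOn) c := by
  rw [dehom, aeval_monomial, monomial_eq, Finsupp.prod_fintype _ _ (by simp),
    Finsupp.prod_fintype _ _ (by simp), Fin.prod_univ_castSucc]
  simp

theorem coeff_dehom {k : Type*} [CommRing k] {N : ℕ} (G : MvPolynomial (Fin (N+1)) k)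
    (m : Fin N →₀ ℕ) :
    coeff m (dehom G) = ∑ v ∈ G.support,
      if v.comapDomain Fin.castSucc (Fin.castSucc_injective N).injOn = m then coeff v G else 0 := by
  have h : dehom G = ∑ v ∈ G.support, dehom (monomial v (coeff v G)) := by
    conv_lhs => rw [G.as_sum]
    simp only [dehom, map_sum]
  rw [h, coeff_sum]
  simp only [dehom_monomial, coeff_monomial]

theorem exists_mem_support_of_mem_support_dehom {k : Type*} [CommRing k] {N : ℕ}
    {G : MvPolynomial (Fin (N+1)) k} {m : Fin N →₀ ℕ} (hm : m ∈ (dehom G).support) :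
    ∃ v ∈ G.support, ∀ i : Fin N, v i.castSucc = m i := by
  rw [mem_support_iff, coeff_dehom] at hm
  obtain ⟨v, hv, h⟩ := Finset.exists_ne_zero_of_sum_ne_zero hm
  refine ⟨v, hv, fun i => ?_⟩
  have h' := (ite_ne_right_iff.mp h).1
  rw [← h', Finsupp.comapDomain_apply]

theorem dehom_ne_zero {k : Type*} [CommRing k] {N d : ℕ} {G : MvPolynomial (Fin (N+1)) k}
    (hG : G.IsHomogeneous d) (hG0 : G ≠ 0) : dehom G ≠ 0 := by
  obtain ⟨v, hv⟩ := support_nonempty.mpr hG0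
  refine ne_zero_iff.mpr ⟨v.comapDomain Fin.castSucc (Fin.castSucc_injective N).injOn, ?_⟩
  rw [coeff_dehom, Finset.sum_eq_single v]
  · simpa using hv
  · intro w hw hwv
    refine if_neg fun h => hwv ?_
    have h' : ∀ i : Fin N, w i.castSucc = v i.castSucc := fun i => by
      simpa using DFunLike.congr_fun h i
    have h1 := sum_eq_of_isHomogeneous hG hw
    have h2 := sum_eq_of_isHomogeneous hG hv
    rw [Fin.sum_univ_castSucc] at h1 h2
    simp only [h'] at h1
    ext i
    refine Fin.lastCases ?_ h' i
    omega
  · exact fun h => absurd hv h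

theorem exists_mem_support_sum_eq_ord0 {k : Type*} [CommSemiring k] {N : ℕ}
    {f : MvPolynomial (Fin N) k} (hf : f ≠ 0) : ∃ m ∈ f.support, ∑ i, m i = ord0 f := by
  have h := support_nonempty.mpr hf
  obtain ⟨m, hm, he⟩ := Finset.exists_mem_eq_inf' h (fun m => ∑ i, m i)
  exact ⟨m, hm, by rw [ord0, dif_pos h, he]⟩

theorem sum_Ico_le_zero_of_pairs {a : ℕ → ℤ} {r : ℕ}
    (h : ∀ u t, u ≤ t → u + t = r → a u + a t ≤ 0) : ∑ i ∈ Finset.Ico 1 r, a i ≤ 0 := by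
  have hrefl : ∑ i ∈ Finset.Ico 1 r, a i = ∑ i ∈ Finset.Ico 1 r, a (r - i) :=
    Finset.sum_nbij' (fun i => r - i) (fun i => r - i)
      (by simp only [Finset.mem_Ico]; omega) (by simp only [Finset.mem_Ico]; omega)
      (by simp only [Finset.mem_Ico]; omega) (by simp only [Finset.mem_Ico]; omega)
      (by
        intro i hi
        rw [Finset.mem_Ico] at hi
        congr 1
        omega)
  have h2 : ∑ i ∈ Finset.Ico 1 r, (a i + a (r - i)) ≤ 0 := by
    refine Finset.sum_nonpos fun i hi => ?_
    rw [Finset.mem_Ico] at hi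
    rcases le_total i (r - i) with h1 | h1
    · exact h _ _ h1 (by omega)
    · rw [add_comm]
      exact h _ _ h1 (by omega)
  rw [Finset.sum_add_distrib, ← hrefl] at h2
  linarith

theorem sum_Ico_le_mul {a : ℕ → ℤ} (ha : Monotone a) (r M : ℕ) :
    ∑ i ∈ Finset.Ico r (M + 1), a i ≤ ((M + 1 - r : ℕ) : ℤ) * a M := by
  refine (Finset.sum_le_card_nsmul _ _ (a M) fun i hi => ha ?_).trans (by simp)
  rw [Finset.mem_Ico] at hi
  omega

/-- If the local order at the most heavily weighted point is `e < δ`, the extremal local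
monomial already has positive weight. -/
theorem weight_pos_of_lt {a₀ b z c d δ e : ℤ} (hz : 0 < z) (hb : b ≤ z) (hc : 0 ≤ c)
    (hs : -a₀ ≤ z + c * b) (he0 : 0 ≤ e) (he : e ≤ δ - 1) (hdeg : (δ - 1) * (c + 2) < d) :
    0 < (d - e) * z + e * a₀ := by
  have h1 : -a₀ ≤ (1 + c) * z := by nlinarith
  have h2 : e * (c + 2) < d := by nlinarith
  nlinarith

/-- If the local order at the most heavily weighted point is `δ`, a local monomial involving the
second most heavily weighted variable has positive weight. -/
theorem weight_pos_of_eq {a₀ b z c d δ : ℤ} (hz : 0 < z) (hbz : 0 < b + z) (hb : b ≤ z)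
    (hc : 0 ≤ c) (hs : -a₀ ≤ z + c * b) (hc0 : c = 0 → a₀ + (d - 1) * z ≤ 0) (hd : 2 ≤ d)
    (hδ : 1 ≤ δ) (hdeg : (δ - 1) * (c + 2) < d) :
    0 < (d - δ) * z + b + (δ - 1) * a₀ := by
  have h1 : (d - 2 * δ + 1) * z + (1 - (δ - 1) * c) * b ≤ (d - δ) * z + b + (δ - 1) * a₀ := by
    nlinarith
  rcases eq_or_lt_of_le hδ with rfl | hδ'
  · nlinarith
  · rcases eq_or_lt_of_le hc with rfl | hc'
    · have h2 := hc0 rfl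
      have h3 : (d - 2) * z ≤ 0 := by linarith
      have h4 : d ≤ 2 := by nlinarith
      omega
    · have h2 : 1 - (δ - 1) * c ≤ 0 := by nlinarith
      nlinarith

theorem monomial_weight_ge {N : ℕ} {α : Fin (N+1) → ℤ} (hα : Monotone α) (m : Fin (N+1) →₀ ℕ) :
    (m (Fin.last N) : ℤ) * α (Fin.last N) + ((∑ i : Fin N, m i.castSucc : ℕ) : ℤ) * α 0 ≤
      ∑ i, (m i : ℤ) * α i := by
  rw [Fin.sum_univ_castSucc, add_comm]
  push_cast
  rw [Finset.sum_mul]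
  gcongr
  exact hα (Fin.zero_le _)

theorem monomial_weight_ge_of_ne_zero {N : ℕ} {α : Fin (N+1) → ℤ} (hα : Monotone α)
    (m : Fin (N+1) →₀ ℕ) {j : Fin N} (hj : m j.castSucc ≠ 0) :
    (m (Fin.last N) : ℤ) * α (Fin.last N) + α j.castSucc +
      (((∑ i : Fin N, m i.castSucc : ℕ) : ℤ) - 1) * α 0 ≤ ∑ i, (m i : ℤ) * α i := by
  have h1 := monomial_weight_ge hα (m - Finsupp.single j.castSucc 1)
  have h2 : m = (m - Finsupp.single j.castSucc 1) + Finsupp.single j.castSucc 1 :=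
    (tsub_add_cancel_of_le (by simpa using Nat.one_le_iff_ne_zero.mpr hj)).symm
  set m' := m - Finsupp.single j.castSucc 1
  rw [h2]
  simp only [Finsupp.add_apply, Finsupp.single_apply, Nat.cast_add, Nat.cast_ite, add_mul,
    Finset.sum_add_distrib]
  simp
  push_cast at h1
  linarith

theorem exists_substGL_eq_rename {k : Type*} [Field k] {n : ℕ}
    (g : Matrix.GeneralLinearGroup (Fin n) k) (F : MvPolynomial (Fin n) k)
    (τ : Equiv.Perm (Fin n)) :
    ∃ g' : Matrix.GeneralLinearGroup (Fin n) k,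
      substGL (↑g') F = rename τ (substGL (↑g) F) := by
  have hdet : (τ.permMatrix k).det ≠ 0 := by
    rw [Matrix.det_permutation]
    rcases Int.units_eq_one_or (Equiv.Perm.sign τ) with h | h <;> simp [h]
  refine ⟨g * Matrix.GeneralLinearGroup.mkOfDetNeZero _ hdet, ?_⟩
  rw [Units.val_mul, ← substGL_substGL, rename_eq_aeval]
  conv_lhs => unfold substGL
  refine DFunLike.congr_fun (congrArg aeval (funext fun i => ?_)) _
  simp [Matrix.GeneralLinearGroup.mkOfDetNeZero, Equiv.Perm.permMatrix, PEquiv.toMatrix_apply]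

theorem not_forall_weight_nonpos_of_monotone {k : Type*} [Field k] {N d : ℕ}
    (hN : 2 ≤ N) (hd : 2 ≤ d) {F : MvPolynomial (Fin (N+1)) k} (hF0 : F ≠ 0)
    (hFhom : F.IsHomogeneous d) {δ : ℕ} (hδ : 1 ≤ δ) {s : ℤ} (hs : -1 ≤ s)
    (hsing : ringKrullDim (MvPolynomial (Fin (N+1)) k ⧸ jacobianIdeal F)
      ≤ ((s+1).toNat : WithBot ℕ∞))
    (hdeg : ((δ : ℤ) - 1) * min ((N : ℤ) + 1) (s + 3) < (d : ℤ))
    (g : Matrix.GeneralLinearGroup (Fin (N+1)) k)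
    (hmult : ord0 (dehom (substGL (↑g) F)) ≤ δ)
    (hcone : ord0 (dehom (substGL (↑g) F)) = δ →
      ∃ m ∈ (dehom (substGL (↑g) F)).support, (∑ i, m i) = δ ∧ m ⟨N-1, by omega⟩ ≠ 0)
    {α : Fin (N+1) → ℤ} (hα : Monotone α) (hα0 : α ≠ 0) (hαsum : ∑ i, α i = 0) :
    ¬ ∀ m ∈ (substGL (↑g) F).support, ∑ i, (m i : ℤ) * α i ≤ 0 := by
  intro hw
  have hG := isHomogeneous_substGL g.val hFhom
  have hG0 : substGL g.val F ≠ 0 := fun h => hF0 (by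
    rw [← substGL_inv_substGL g F, h, substGL, map_zero])
  have hpair : ∀ p q : Fin (N+1), p ≤ q → (p : ℕ) + q + (s+1).toNat ≤ N →
      α p + ((d : ℤ) - 1) * α q ≤ 0 := fun p q h1 h2 =>
    weight_pair_le_zero hd hFhom hsing g hα hw h1 h2
  obtain ⟨a, ha, haα⟩ : ∃ a : ℕ → ℤ, Monotone a ∧ ∀ i : Fin (N+1), α i = a i :=
    ⟨fun i => α ⟨min i N, by omega⟩, fun i j hij => hα (Fin.mk_le_mk.mpr (by omega)),
      fun i => congrArg α (Fin.ext (by simp; omega))⟩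
  have hpair' : ∀ u t : ℕ, u ≤ t → u + t + (s+1).toNat ≤ N → a u + ((d : ℤ) - 1) * a t ≤ 0 := by
    intro u t h1 h2
    have := hpair ⟨u, by omega⟩ ⟨t, by omega⟩ h1 h2
    rwa [haα, haα] at this
  have hd' : (2 : ℤ) ≤ d := by exact_mod_cast hd
  have hδ' : (1 : ℤ) ≤ δ := by exact_mod_cast hδ
  obtain ⟨M, rfl⟩ : ∃ M, N = M + 1 := ⟨N - 1, by omega⟩
  have hsum : a 0 + ∑ i ∈ Finset.Ico 1 (M + 1), a i + a (M + 1) = 0 := by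
    rw [← hαsum, Fintype.sum_congr _ _ haα, Fin.sum_univ_eq_sum_range a, Finset.sum_range_succ,
      Finset.range_eq_Ico, ← Finset.sum_eq_sum_Ico_succ_bot (by omega) a]
  have hb : a M ≤ a (M + 1) := ha (by omega)
  have hbound := sum_Ico_le_mul ha 1 M
  rw [Nat.add_sub_cancel] at hbound
  have h0b : a 0 ≤ a M := ha (by omega)
  have hM : (1 : ℤ) ≤ M := by omega
  have hz : 0 < a (M + 1) := by
    by_contra! hz
    refine hα0 (funext fun i => ?_)
    have hle : ∀ j ∈ Finset.univ, α j ≤ 0 := fun j _ => by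
      rw [haα]; exact (ha (by omega)).trans hz
    exact (Finset.sum_eq_zero_iff_of_nonpos hle).mp hαsum i (Finset.mem_univ i)
  have hbz : 0 < a M + a (M + 1) := by nlinarith
  obtain ⟨c, hc, hcs, hc0, hcdeg⟩ : ∃ c : ℤ, 0 ≤ c ∧ -a 0 ≤ a (M + 1) + c * a M ∧
      (c = 0 → a 0 + ((d : ℤ) - 1) * a (M + 1) ≤ 0) ∧ ((δ : ℤ) - 1) * (c + 2) < d := by
    rcases le_or_gt ((M + 1 : ℕ) + 1 : ℤ) (s + 3) with h | h
    · rw [min_eq_left h] at hdeg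
      refine ⟨M, by omega, by linarith, by omega, ?_⟩
      push_cast at hdeg
      linarith
    · rw [min_eq_right h.le] at hdeg
      refine ⟨s + 1, by omega, ?_, fun hs0 => hpair' 0 (M + 1) (by omega) (by omega), by linarith⟩
      obtain ⟨r, hr⟩ : ∃ r : ℕ, (r : ℤ) = M - s := ⟨(M - s).toNat, by omega⟩
      have h1 : ∑ i ∈ Finset.Ico 1 r, a i ≤ 0 := by
        refine sum_Ico_le_zero_of_pairs fun u t hut hur => ?_
        have h2 := hpair' u t hut (by omega)
        have h3 := ha hut
        rcases le_or_gt (a t) 0 with h4 | h4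
        · linarith
        · nlinarith
      have h2 := sum_Ico_le_mul ha r M
      have h3 := Finset.sum_Ico_consecutive a (show 1 ≤ r by omega) (show r ≤ M + 1 by omega)
      have h4 : ((M + 1 - r : ℕ) : ℤ) = s + 1 := by omega
      rw [h4] at h2
      linarith
  have hdehom := dehom_ne_zero hG hG0
  have hlast : ∀ v ∈ (substGL g.val F).support, ∀ m : Fin (M + 1) →₀ ℕ,
      (∀ i, v (Fin.castSucc i) = m i) →
      (v (Fin.last (M + 1)) : ℤ) = d - ((∑ i, m i : ℕ) : ℤ) := by
    intro v hv m hvm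
    have h := sum_eq_of_isHomogeneous hG hv
    rw [Fin.sum_univ_castSucc] at h
    simp only [hvm] at h
    omega
  rcases eq_or_lt_of_le hmult with he | he
  · obtain ⟨m, hm, hmsum, hm0⟩ := hcone he
    obtain ⟨v, hv, hvm⟩ := exists_mem_support_of_mem_support_dehom hm
    have h1 := monomial_weight_ge_of_ne_zero hα v (j := ⟨M, by omega⟩)
      (by rw [hvm]; exact hm0)
    rw [hlast v hv m hvm, haα, haα, haα] at h1
    simp only [hvm, hmsum, Fin.val_last, Fin.val_castSucc, Fin.val_zero] at h1
    have h2 := weight_pos_of_eq hz hbz hb hc hcs hc0 hd' hδ' hcdeg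
    linarith [hw v hv]
  · obtain ⟨m, hm, hmsum⟩ := exists_mem_support_sum_eq_ord0 hdehom
    obtain ⟨v, hv, hvm⟩ := exists_mem_support_of_mem_support_dehom hm
    have h1 := monomial_weight_ge hα v
    rw [hlast v hv m hvm, haα, haα] at h1
    simp only [hvm, hmsum, Fin.val_last, Fin.val_zero] at h1
    have h2 := weight_pos_of_lt (e := (ord0 (dehom (substGL g.val F)) : ℤ)) hz hb hc hcs
      (by omega) (by omega) hcdeg
    linarith [hw v hv]

/-- Assume `N ≥ 2`. If the multiplicity of `H = {F = 0}` at every point is at most `δ`,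
at every point of multiplicity exactly `δ` the lowest-degree homogeneous part of the
local equation contains a monomial involving `x_{N-1}` (i.e. the projective tangent
cone is not a cone over a hypersurface in a projective hyperplane), `dim H_sing ≤ s`,
and `d > (δ-1) · min(N+1, s+3)`, then `F` satisfies the Hilbert–Mumford criterion for
stability, i.e. `H` is stable. -/
theorem stable_of_deg_gt_of_tangentCone_not_cone {k : Type*} [Field k] [IsAlgClosed k]
    {N d : ℕ} (hN : 2 ≤ N) (hd : 2 ≤ d)
    (F : MvPolynomial (Fin (N+1)) k) (hF0 : F ≠ 0) (hFhom : F.IsHomogeneous d)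
    (δ : ℕ) (hδ : 1 ≤ δ)
    (hmult : ∀ h : Matrix.GeneralLinearGroup (Fin (N+1)) k,
      ord0 (dehom (substGL (↑h) F)) ≤ δ)
    (hcone : ∀ h : Matrix.GeneralLinearGroup (Fin (N+1)) k,
      ord0 (dehom (substGL (↑h) F)) = δ →
      ∃ m ∈ (dehom (substGL (↑h) F)).support,
        (∑ i, m i) = δ ∧ m ⟨N-1, by omega⟩ ≠ 0)
    (s : ℤ) (hs : -1 ≤ s)
    (hsing : ringKrullDim (MvPolynomial (Fin (N+1)) k ⧸ jacobianIdeal F)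
      ≤ ((s+1).toNat : WithBot ℕ∞))
    (hdeg : ((δ : ℤ) - 1) * min ((N : ℤ) + 1) (s + 3) < (d : ℤ)) :
    ∀ g : Matrix.GeneralLinearGroup (Fin (N+1)) k, ∀ α : Fin (N+1) → ℤ,
      α ≠ 0 → (∑ i, α i) = 0 → 0 < adeg α (substGL (↑g) F) := by
  intro g α hα0 hαsum
  by_contra! hadeg
  have hG0 : substGL g.val F ≠ 0 := fun h => hF0 (by
    rw [← substGL_inv_substGL g F, h, substGL, map_zero])
  have hw : ∀ m ∈ (substGL g.val F).support, ∑ i, (m i : ℤ) * α i ≤ 0 := fun m hm => by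
    rw [adeg, dif_pos (support_nonempty.mpr hG0)] at hadeg
    exact (Finset.le_sup' (fun m : Fin (N+1) →₀ ℕ => ∑ i, (m i : ℤ) * α i) hm).trans hadeg
  obtain ⟨g', hg'⟩ := exists_substGL_eq_rename g F (Tuple.sort α).symm
  have hmono := Tuple.monotone_sort α
  refine not_forall_weight_nonpos_of_monotone hN hd hF0 hFhom hδ hs hsing hdeg g' (hmult g')
    (hcone g') hmono ?_ ?_ ?_
  · intro h
    refine hα0 (funext fun i => ?_)
    have := congrFun h ((Tuple.sort α).symm i)
    simpa using this
  · rw [← hαsum]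
    exact Equiv.sum_comp (Tuple.sort α) α
  · rw [hg', support_rename_of_injective (Equiv.injective _)]
    simp only [Finset.mem_image, forall_exists_index, and_imp, forall_apply_eq_imp_iff₂]
    intro m hm
    refine le_of_eq_of_le ?_ (hw m hm)
    rw [← Equiv.sum_comp (Tuple.sort α) (fun i => (m i : ℤ) * α i)]
    refine Finset.sum_congr rfl fun i _ => ?_
    rw [← Finsupp.equivMapDomain_eq_mapDomain, Finsupp.equivMapDomain_apply, Equiv.symm_symm,
      Function.comp_apply]
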